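/- For every integer d ≥ 4 and every vector ω₀ ∈ ℝ^d whose coordinates are not all of the same sign, there exist a C^∞ function H : ℝ^{2d} → ℝ with H(x,y) = ⟨ω₀, r(x,y)⟩ + O³(x,y) (i.e. H − ⟨ω₀, r⟩ vanishes at the origin together with its first and second total derivatives) and a global flow Φ of X_H that is diffusive: for every A > 0 there exist a point p ∈ ℝ^{2d} and times t₁, t₂ ∈ ℝ with |Φ(t₁,p)| ≤ A⁻¹ and |Φ(t₂,p)| ≥ A. -/

import Mathlib

open Filter Topology Metric Set

noncomputable section

/-- Phase space `ℝ^d × ℝ^d`, a point is `p = (x, y)`. -/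
abbrev Ph (d : ℕ) := (Fin d → ℝ) × (Fin d → ℝ)

/-- Action coordinates `r_j(p) = (x_j² + y_j²)/2`. -/
def actJ {d : ℕ} (j : Fin d) (p : Ph d) : ℝ := (p.1 j ^ 2 + p.2 j ^ 2) / 2

/-- The Hamiltonian vector field `X_H = (∂H/∂y, -∂H/∂x)`. -/
def hamVF {d : ℕ} (H : Ph d → ℝ) (p : Ph d) : Ph d :=
  (fun j => fderiv ℝ H p (0, Pi.single j 1),
   fun j => - fderiv ℝ H p (Pi.single j 1, 0))

/-- `Φ` is a global flow of the Hamiltonian vector field `X_H`. -/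
def IsGlobalFlow {d : ℕ} (H : Ph d → ℝ) (Φ : ℝ → Ph d → Ph d) : Prop :=
  (∀ p, Φ 0 p = p) ∧ (∀ s t p, Φ (s + t) p = Φ s (Φ t p)) ∧
  (∀ p t, HasDerivAt (fun τ => Φ τ p) (hamVF H (Φ t p)) t)

/-- `H(x,y) = ⟨ω, r(x,y)⟩ + O³(x,y)`: the difference `H - ⟨ω, r⟩` vanishes at the
origin together with its first and second total derivatives. -/
def IsEllipticNF {d : ℕ} (ω : Fin d → ℝ) (H : Ph d → ℝ) : Prop :=
  ∀ k ≤ 2, iteratedFDeriv ℝ k (fun p => H p - ∑ j, ω j * actJ j p) 0 = 0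

section GlobalFlow

variable {E : Type*} [NormedAddCommGroup E] [NormedSpace ℝ E] {v : E → E} {K : NNReal}

lemma LipschitzWith.exists_integralCurve_Ioo [CompleteSpace E] (hv : LipschitzWith K v)
    (hK : 0 < K) (x : E) : ∃ γ : ℝ → E, γ 0 = x ∧
      ∀ t ∈ Ioo (-(2 * K : ℝ)⁻¹) (2 * K : ℝ)⁻¹, HasDerivAt γ (v (γ t)) t := by
  set ε : ℝ := (2 * K : ℝ)⁻¹ with hε
  have hε0 : 0 < ε := by positivity
  set L : NNReal := 2 * ‖v x‖₊ with hL
  have hb : ∀ y ∈ closedBall x ((‖v x‖₊ / K : NNReal) : ℝ), ‖v y‖ ≤ L := by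
    intro y hy
    have h1 : ‖v y - v x‖ ≤ K * ‖y - x‖ := by
      simpa [dist_eq_norm] using hv.dist_le_mul y x
    have h2 : ‖y - x‖ ≤ ‖v x‖ / K := by simpa [dist_eq_norm] using hy
    have h3 : K * ‖y - x‖ ≤ ‖v x‖ := by
      rw [le_div_iff₀ (by exact_mod_cast hK)] at h2; linarith
    have h4 : ‖v y‖ ≤ ‖v y - v x‖ + ‖v x‖ := by simpa using norm_add_le (v y - v x) (v x)
    simp only [hL, NNReal.coe_mul, NNReal.coe_ofNat, coe_nnnorm]
    linarith
  have hpl : IsPicardLindelof (fun _ ↦ v) (tmin := -ε) (tmax := ε)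
      ⟨0, by constructor <;> linarith⟩ x (‖v x‖₊ / K) 0 L K := by
    refine .of_time_independent hb hv.lipschitzOnWith ?_
    have : (K : ℝ) ≠ 0 := by exact_mod_cast hK.ne'
    simp only [hL, hε, sub_zero, zero_sub, neg_neg, max_self, NNReal.coe_mul, NNReal.coe_div,
      NNReal.coe_ofNat, coe_nnnorm, NNReal.coe_zero]
    apply le_of_eq
    field_simp
  obtain ⟨γ, h0, h⟩ := hpl.exists_eq_forall_mem_Icc_hasDerivWithinAt₀
  exact ⟨γ, h0, fun t ht ↦ (h t (Ioo_subset_Icc_self ht)).hasDerivAt (Icc_mem_nhds ht.1 ht.2)⟩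

lemma LipschitzWith.exists_integralCurve [CompleteSpace E] (hv : LipschitzWith K v)
    (hC : ContDiff ℝ 1 v) (x : E) :
    ∃ γ : ℝ → E, γ 0 = x ∧ ∀ t, HasDerivAt γ (v (γ t)) t := by
  have hv' : LipschitzWith (K + 1) v := hv.weaken (by simp)
  have hK : 0 < K + 1 := by positivity
  have hM := exists_isMIntegralCurve_of_isMIntegralCurveOn (I := modelWithCornersSelf ℝ E) (v := v)
    (contMDiff_vectorSpace_iff_contDiff.2 hC) (ε := (2 * (K + 1 : NNReal) : ℝ)⁻¹) (by positivity)
    (fun y ↦ by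
      obtain ⟨γ, h0, h⟩ := hv'.exists_integralCurve_Ioo hK y
      refine ⟨γ, h0, fun t ht ↦ ?_⟩
      have hd := (h t ht).hasFDerivAt
      exact hd.hasMFDerivAt.hasMFDerivWithinAt) x
  obtain ⟨γ, h0, h⟩ := hM
  refine ⟨γ, h0, fun t ↦ ?_⟩
  have hd : HasFDerivAt γ (ContinuousLinearMap.smulRight (1 : ℝ →L[ℝ] ℝ) (v (γ t))) t :=
    hasMFDerivAt_iff_hasFDerivAt.1 (h t)
  simpa using hd.hasDerivAt

lemma LipschitzWith.exists_flow [CompleteSpace E] (hv : LipschitzWith K v)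
    (hC : ContDiff ℝ 1 v) : ∃ Φ : ℝ → E → E, (∀ p, Φ 0 p = p) ∧
      (∀ s t p, Φ (s + t) p = Φ s (Φ t p)) ∧ ∀ p t, HasDerivAt (fun τ ↦ Φ τ p) (v (Φ t p)) t := by
  choose γ h0 h using hv.exists_integralCurve hC
  refine ⟨fun t p ↦ γ p t, h0, fun s t p ↦ ?_, h⟩
  have := ODE_solution_unique_univ (v := fun _ ↦ v) (s := fun _ ↦ univ) (t₀ := 0)
    (f := fun s ↦ γ p (s + t)) (g := γ (γ p t)) (fun _ ↦ hv.lipschitzOnWith)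
    (fun s ↦ ⟨(h p (s + t)).comp_add_const s t, mem_univ _⟩)
    (fun s ↦ ⟨h _ s, mem_univ _⟩) (by simp [h0])
  exact congrFun this s

end GlobalFlow

section VectorField

variable {d : ℕ}

/-- The integrable quadratic Hamiltonian `⟨ω, r⟩`. -/
def quadHam (ω : Fin d → ℝ) (p : Ph d) : ℝ := ∑ j, ω j * actJ j p

/-- The linear isomorphism `(Ph d)* → Ph d` given by the standard symplectic form. -/
def symplecticSharp (d : ℕ) : (Ph d →L[ℝ] ℝ) →ₗ[ℝ] Ph d where
  toFun f := (fun j => f (0, Pi.single j 1), fun j => - f (Pi.single j 1, 0))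
  map_add' f g := by ext j <;> simp [add_comm]
  map_smul' c f := by ext j <;> simp

lemma hamVF_eq_symplecticSharp (H : Ph d → ℝ) :
    hamVF H = (symplecticSharp d).toContinuousLinearMap ∘ fderiv ℝ H := rfl

lemma hamVF_add {H G : Ph d → ℝ} (hH : Differentiable ℝ H) (hG : Differentiable ℝ G) :
    hamVF (fun p => H p + G p) = fun p => hamVF H p + hamVF G p := by
  ext1 p
  simp only [hamVF_eq_symplecticSharp, Function.comp_apply,
    fderiv_fun_add (hH p) (hG p), map_add]

lemma hamVF_congr {H G : Ph d → ℝ} {p : Ph d} (h : H =ᶠ[𝓝 p] G) : hamVF H p = hamVF G p := by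
  simp only [hamVF_eq_symplecticSharp, Function.comp_apply, h.fderiv_eq]

lemma contDiff_hamVF {H : Ph d → ℝ} (hH : ContDiff ℝ (⊤ : ℕ∞) H) : ContDiff ℝ 1 (hamVF H) := by
  have h : ContDiff ℝ 1 (fderiv ℝ H) := hH.fderiv_right (WithTop.coe_le_coe.2 le_top)
  rw [hamVF_eq_symplecticSharp]
  exact (ContinuousLinearMap.contDiff _).comp h

@[fun_prop]
lemma contDiff_actJ {n : WithTop ℕ∞} (k : Fin d) : ContDiff ℝ n (actJ (d := d) k) := by
  unfold actJ; fun_prop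

lemma contDiff_quadHam {n : WithTop ℕ∞} (ω : Fin d → ℝ) : ContDiff ℝ n (quadHam ω) := by
  unfold quadHam; fun_prop

lemma hasFDerivAt_actJ (k : Fin d) (p : Ph d) :
    HasFDerivAt (actJ k)
      (p.1 k • (ContinuousLinearMap.proj k ∘L ContinuousLinearMap.fst ℝ (Fin d → ℝ) (Fin d → ℝ)) +
       p.2 k • (ContinuousLinearMap.proj k ∘L ContinuousLinearMap.snd ℝ (Fin d → ℝ) (Fin d → ℝ)) :
        Ph d →L[ℝ] ℝ) p := by
  have h1 := (ContinuousLinearMap.proj (R := ℝ) (φ := fun _ : Fin d => ℝ) k ∘L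
    ContinuousLinearMap.fst ℝ (Fin d → ℝ) (Fin d → ℝ)).hasFDerivAt (x := p)
  have h2 := (ContinuousLinearMap.proj (R := ℝ) (φ := fun _ : Fin d => ℝ) k ∘L
    ContinuousLinearMap.snd ℝ (Fin d → ℝ) (Fin d → ℝ)).hasFDerivAt (x := p)
  refine (((h1.pow 2).add (h2.pow 2)).mul_const (1 / 2 : ℝ)).congr_fderiv ?_ |>.congr_of_eventuallyEq
    (.of_forall fun q => ?_)
  · ext v <;> simp <;> ring
  · simp [actJ]; ring

lemma hamVF_quadHam (ω : Fin d → ℝ) (p : Ph d) :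
    hamVF (quadHam ω) p = (fun k => ω k * p.2 k, fun k => -(ω k * p.1 k)) := by
  have h : HasFDerivAt (quadHam ω) _ p :=
    HasFDerivAt.fun_sum fun j (_ : j ∈ Finset.univ) => (hasFDerivAt_actJ j p).const_mul (ω j)
  unfold hamVF
  rw [h.fderiv]
  ext k <;> simp [Pi.single_apply]

/-- The linear vector field `hamVF (quadHam ω)`. -/
def quadField (ω : Fin d → ℝ) : Ph d →ₗ[ℝ] Ph d where
  toFun p := (fun k => ω k * p.2 k, fun k => -(ω k * p.1 k))
  map_add' p q := by ext k <;> simp <;> ring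
  map_smul' c p := by ext k <;> simp <;> ring

lemma exists_lipschitzWith_hamVF_quadHam (ω : Fin d → ℝ) :
    ∃ K, LipschitzWith K (hamVF (quadHam ω)) := by
  have : hamVF (quadHam ω) = (quadField ω).toContinuousLinearMap := by
    ext1 p; exact hamVF_quadHam ω p
  exact ⟨_, this ▸ ContinuousLinearMap.lipschitz _⟩

end VectorField

section Series

variable {E : Type*} [NormedAddCommGroup E] [NormedSpace ℝ E]

lemma lipschitzWith_fderiv_of_iteratedFDeriv_two_le {f : E → ℝ} {C : NNReal}
    (hf : ContDiff ℝ 2 f) (hC : ∀ x, ‖iteratedFDeriv ℝ 2 f x‖ ≤ C) :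
    LipschitzWith C (fderiv ℝ f) := by
  have h1 : ContDiff ℝ 1 (fderiv ℝ f) := hf.fderiv_right (by norm_num)
  refine lipschitzWith_of_nnnorm_fderiv_le (h1.differentiable (by norm_num)) fun x => ?_
  rw [← NNReal.coe_le_coe, coe_nnnorm, ← norm_iteratedFDeriv_one, norm_iteratedFDeriv_fderiv]
  exact hC x

lemma contDiff_tsum_of_geometric {T : ℕ → E → ℝ} (hT : ∀ n, ContDiff ℝ (⊤ : ℕ∞) (T n))
    (hb : ∀ n, ∀ k ≤ n + 2, ∀ x, ‖iteratedFDeriv ℝ k (T n) x‖ ≤ (1 / 2 : ℝ) ^ n) :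
    ContDiff ℝ (⊤ : ℕ∞) (fun x => ∑' n, T n x) := by
  refine contDiff_tsum_of_eventually (v := fun _ n => (1 / 2 : ℝ) ^ n) hT
    (fun _ _ => summable_geometric_two) fun k _ => ?_
  rw [Nat.cofinite_eq_atTop]
  filter_upwards [eventually_ge_atTop k] with n hn x
  exact hb n k (by omega) x

lemma iteratedFDeriv_tsum_of_geometric {T : ℕ → E → ℝ} (hT : ∀ n, ContDiff ℝ (⊤ : ℕ∞) (T n))
    (hb : ∀ n, ∀ k ≤ n + 2, ∀ x, ‖iteratedFDeriv ℝ k (T n) x‖ ≤ (1 / 2 : ℝ) ^ n)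
    {k : ℕ} (hk : k ≤ 2) :
    iteratedFDeriv ℝ k (fun x => ∑' n, T n x) = fun x => ∑' n, iteratedFDeriv ℝ k (T n) x :=
  iteratedFDeriv_tsum (N := 2) (v := fun _ n => (1 / 2 : ℝ) ^ n)
    (fun n => (hT n).of_le (WithTop.coe_le_coe.2 le_top))
    (fun _ _ => summable_geometric_two)
    (fun m n x hm => hb n m (by have : m ≤ 2 := by exact_mod_cast hm
                                omega) x) (by exact_mod_cast hk)

lemma lipschitzWith_fderiv_tsum_of_geometric {T : ℕ → E → ℝ} (hT : ∀ n, ContDiff ℝ (⊤ : ℕ∞) (T n))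
    (hb : ∀ n, ∀ k ≤ n + 2, ∀ x, ‖iteratedFDeriv ℝ k (T n) x‖ ≤ (1 / 2 : ℝ) ^ n) :
    LipschitzWith 2 (fderiv ℝ (fun x => ∑' n, T n x)) := by
  refine lipschitzWith_fderiv_of_iteratedFDeriv_two_le
    ((contDiff_tsum_of_geometric hT hb).of_le (WithTop.coe_le_coe.2 le_top)) fun x => ?_
  rw [iteratedFDeriv_tsum_of_geometric hT hb le_rfl]
  exact tsum_of_norm_bounded hasSum_geometric_two fun n => hb n 2 (by omega) x

end Series

section Cutoff

variable {E : Type*} [NormedAddCommGroup E] [NormedSpace ℝ E]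

lemma exists_norm_iteratedFDeriv_const_mul_le {F : E → ℝ}
    (hc : HasCompactSupport F) (hF : ContDiff ℝ (⊤ : ℕ∞) F) (N : ℕ) {η : ℝ} (hη : 0 < η) :
    ∃ ε > 0, ∀ c : ℝ, |c| ≤ ε → ∀ k ≤ N, ∀ x, ‖iteratedFDeriv ℝ k (fun y => c * F y) x‖ ≤ η := by
  have hbd (k : ℕ) : ∃ C, ∀ x, ‖iteratedFDeriv ℝ k F x‖ ≤ C :=
    (hc.iteratedFDeriv k).exists_bound_of_continuous
      (hF.continuous_iteratedFDeriv (WithTop.coe_le_coe.2 le_top))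
  choose C hC using hbd
  have hC0 (k : ℕ) : 0 ≤ C k := (norm_nonneg _).trans (hC k 0)
  set D := ∑ k ∈ Finset.range (N + 1), C k
  have hD : 0 ≤ D := Finset.sum_nonneg fun k _ => hC0 k
  refine ⟨η / (D + 1), by positivity, fun c hc' k hk x => ?_⟩
  have h1 : iteratedFDeriv ℝ k (fun y => c * F y) x = c • iteratedFDeriv ℝ k F x :=
    iteratedFDeriv_const_smul_apply (a := c) (hF.contDiffAt.of_le (WithTop.coe_le_coe.2 le_top))
  have h2 : C k ≤ D :=
    Finset.single_le_sum (fun k _ => hC0 k) (Finset.mem_range.2 (Nat.lt_succ_of_le hk))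
  rw [h1, norm_smul, Real.norm_eq_abs]
  calc |c| * ‖iteratedFDeriv ℝ k F x‖ ≤ η / (D + 1) * (D + 1) := by
        gcongr
        linarith [hC k x]
    _ = η := by field_simp

lemma ContDiffBump.contDiff_mul_inv_pow {c : ℝ} (χ : ContDiffBump c) (hχ : χ.rOut < c) (m : ℕ) :
    ContDiff ℝ (⊤ : ℕ∞) (fun u => χ u * (u ^ m)⁻¹) := by
  rw [contDiff_iff_contDiffAt]
  intro u
  by_cases hu : u = 0
  · have h0 : ∀ᶠ v in 𝓝 u, χ.rOut < dist v c := by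
      refine continuousAt_const.eventually_lt (continuousAt_id.dist continuousAt_const) ?_
      simpa [hu, dist_eq_norm] using hχ.trans_le (le_abs_self c)
    refine (contDiffAt_const (c := (0 : ℝ))).congr_of_eventuallyEq ?_
    filter_upwards [h0] with v hv
    rw [χ.zero_of_le_dist hv.le, zero_mul]
  · exact χ.contDiff.contDiffAt.mul ((contDiffAt_id.pow m).inv (pow_ne_zero m hu))

end Cutoff

section Resonance

lemma exists_resonant_shift {α β δ₀ : ℝ} (h : α * β < 0) (hδ₀ : 0 < δ₀) :
    ∃ (δ : ℝ) (q p : ℕ), |δ| ≤ δ₀ ∧ 0 < q ∧ 0 < p ∧ q * (α + δ) + p * β = 0 := by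
  have hβ : β ≠ 0 := by rintro rfl; simp at h
  have hpos : 0 < -α / β := by
    rw [← mul_pos_iff_of_pos_right (show 0 < β ^ 2 by positivity)]
    have : -α / β * β ^ 2 = -(α * β) := by field_simp
    linarith
  obtain ⟨u, hu1, hu2⟩ := exists_rat_btwn
    (show -α / β < -α / β + δ₀ / |β| by linarith [div_pos hδ₀ (abs_pos.2 hβ)])
  have hu : 0 < u := by exact_mod_cast hpos.trans hu1
  refine ⟨-u * β - α, u.den, u.num.toNat, ?_, u.den_pos, ?_, ?_⟩
  · have h1 : -(u : ℝ) * β - α = -(β * (u - -α / β)) := by field_simp; ring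
    rw [h1, abs_neg, abs_mul, abs_of_pos (show 0 < (u : ℝ) - -α / β by linarith)]
    have h2 : (u : ℝ) - -α / β ≤ δ₀ / |β| := by linarith
    calc |β| * ((u : ℝ) - -α / β) ≤ |β| * (δ₀ / |β|) := by gcongr
      _ = δ₀ := by have := abs_ne_zero.2 hβ; field_simp
  · have := Rat.num_pos.2 hu; omega
  · have h1 : ((u.num.toNat : ℕ) : ℝ) = (u.num : ℝ) := by
      have := Int.toNat_of_nonneg (Rat.num_pos.2 hu).le
      exact_mod_cast congrArg (Int.cast (R := ℝ)) this
    have h2 : (u : ℝ) * u.den = u.num := by exact_mod_cast Rat.mul_den_eq_num u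
    rw [h1, ← h2]; ring

variable {d : ℕ}

/-- The complex coordinate `x_k + i y_k`. -/
def complexCoord (k : Fin d) : Ph d →L[ℝ] ℂ :=
  Complex.equivRealProdCLM.symm.toContinuousLinearMap ∘L
    ((ContinuousLinearMap.proj k ∘L ContinuousLinearMap.fst ℝ (Fin d → ℝ) (Fin d → ℝ)).prod
      (ContinuousLinearMap.proj k ∘L ContinuousLinearMap.snd ℝ (Fin d → ℝ) (Fin d → ℝ)))

@[simp]
lemma complexCoord_re (k : Fin d) (x : Ph d) : (complexCoord k x).re = x.1 k := by
  simp [complexCoord]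

@[simp]
lemma complexCoord_im (k : Fin d) (x : Ph d) : (complexCoord k x).im = x.2 k := by
  simp [complexCoord]

lemma complexCoord_mul_conj (k : Fin d) (x : Ph d) :
    complexCoord k x * (starRingEnd ℂ) (complexCoord k x) = ((2 * actJ k x : ℝ) : ℂ) := by
  rw [Complex.mul_conj, Complex.normSq_apply]
  simp [actJ]; ring

/-- The monomial `z_i ^ q * z_j ^ p`. -/
def monomial (i j : Fin d) (q p : ℕ) (x : Ph d) : ℂ := complexCoord i x ^ q * complexCoord j x ^ p

lemma contDiff_monomial {n : WithTop ℕ∞} (i j : Fin d) (q p : ℕ) :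
    ContDiff ℝ n (monomial i j q p) :=
  ((complexCoord i).contDiff.pow q).mul ((complexCoord j).contDiff.pow p)

lemma hasFDerivAt_monomial (i j : Fin d) (q p : ℕ) (x : Ph d) :
    HasFDerivAt (monomial i j q p)
      ((q * complexCoord i x ^ (q - 1) * complexCoord j x ^ p) • complexCoord i +
        (p * complexCoord j x ^ (p - 1) * complexCoord i x ^ q) • complexCoord j) x := by
  refine ((((complexCoord i).hasFDerivAt (x := x)).pow q).mul
    (((complexCoord j).hasFDerivAt (x := x)).pow p)).congr_fderiv ?_
  refine ContinuousLinearMap.ext fun v => ?_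
  simp
  ring

lemma natCast_mul_pow_pred_mul_eq {z w : ℂ} {q : ℕ} (hq : 0 < q) {s N : ℝ} (hs : 0 < s)
    (hz : z * (starRingEnd ℂ) z = ((2 * (q * s) : ℝ) : ℂ)) (hw : z ^ q * w = -Complex.I * N) :
    q * z ^ (q - 1) * w = -Complex.I * (N / (2 * s) : ℝ) * (starRingEnd ℂ) z := by
  have hs' : (s : ℂ) ≠ 0 := by exact_mod_cast hs.ne'
  have hq' : (q : ℂ) ≠ 0 := by exact_mod_cast hq.ne'
  have hpow : z ^ q = z ^ (q - 1) * z := by rw [← pow_succ, Nat.sub_add_cancel hq]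
  push_cast at hz ⊢
  have h1 : (q * z ^ (q - 1) * w) * (2 * (q * s)) = q * (-Complex.I * N) * (starRingEnd ℂ) z := by
    rw [← hz, ← hw, hpow]; ring
  field_simp
  have h2 : (q : ℂ) * (z ^ (q - 1) * q * w * (s * 2)) =
      q * -((starRingEnd ℂ) z * Complex.I * N) := by
    linear_combination h1
  have := mul_left_cancel₀ hq' h2
  linear_combination this

lemma hamVF_quadHam_add_resonant {i j : Fin d} (hij : i ≠ j) (ν : Fin d → ℝ) {q p : ℕ}
    (hq : 0 < q) (hp : 0 < p) {x : Ph d} {s N : ℝ} (hs : 0 < s) (hi : actJ i x = q * s)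
    (hj : actJ j x = p * s) (hM : monomial i j q p x = -Complex.I * N) {h : Ph d → ℝ}
    (hh : DifferentiableAt ℝ h x) :
    hamVF (fun y => quadHam ν y + h y * (monomial i j q p y).re) x =
      (fun k => (if k = i ∨ k = j then h x * (N / (2 * s)) else 0) * x.1 k + ν k * x.2 k,
        fun k => (if k = i ∨ k = j then h x * (N / (2 * s)) else 0) * x.2 k - ν k * x.1 k) := by
  have hre := Complex.reCLM.hasFDerivAt.comp x (hasFDerivAt_monomial i j q p x)
  have hre0 : (Complex.reCLM ∘ monomial i j q p) x = 0 := by simp [hM]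
  have hi' := natCast_mul_pow_pred_mul_eq hq hs
    (by rw [complexCoord_mul_conj, hi]) (hM : complexCoord i x ^ q * complexCoord j x ^ p = _)
  have hj' := natCast_mul_pow_pred_mul_eq hp hs
    (by rw [complexCoord_mul_conj, hj])
    ((mul_comm _ _).trans hM : complexCoord j x ^ p * complexCoord i x ^ q = _)
  have hP := hh.hasFDerivAt.mul hre
  rw [hre0, zero_smul, add_zero, hi', hj'] at hP
  have hPd : hamVF (fun y => h y * (monomial i j q p y).re) x =
      (fun k => (if k = i ∨ k = j then h x * (N / (2 * s)) else 0) * x.1 k,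
        fun k => (if k = i ∨ k = j then h x * (N / (2 * s)) else 0) * x.2 k) := by
    have hP' : fderiv ℝ (fun y => h y * (monomial i j q p y).re) x = _ := hP.fderiv
    unfold hamVF
    rw [hP']
    clear hP' hP hi' hj' hre hre0
    have hc (k k' : Fin d) : complexCoord k ((0, Pi.single k' 1) : Ph d) =
        if k = k' then Complex.I else 0 := by
      apply Complex.ext <;> by_cases hk : k = k' <;> simp [hk]
    have hc' (k k' : Fin d) : complexCoord k ((Pi.single k' 1, 0) : Ph d) =
        if k = k' then 1 else 0 := by
      apply Complex.ext <;> by_cases hk : k = k' <;> simp [hk]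
    generalize N / (2 * s) = μ
    ext k
    · rcases eq_or_ne k i with rfl | hki
      · simp [hc, hij.symm]; ring
      rcases eq_or_ne k j with rfl | hkj
      · simp [hc, hij]; ring
      simp [hc, hki, hkj, hki.symm, hkj.symm]
    · rcases eq_or_ne k i with rfl | hki
      · simp [hc', hij.symm]; ring
      rcases eq_or_ne k j with rfl | hkj
      · simp [hc', hij]; ring
      simp [hc', hki, hkj, hki.symm, hkj.symm]
  have hQ := hamVF_quadHam ν x
  rw [hamVF_eq_symplecticSharp] at hPd hQ ⊢
  simp only [Function.comp_apply] at hPd hQ ⊢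
  rw [fderiv_fun_add (g := fun y => h y * (monomial i j q p y).re)
    ((contDiff_quadHam (n := 1) ν).differentiable (by norm_num) x) hP.differentiableAt, map_add,
    hQ, hPd]
  ext k <;> simp <;> ring

/-- The curve whose `k`-th complex coordinate is `c_k exp ((κ_k - i ν_k) t)`. -/
def spiral (c : Fin d → ℂ) (κ ν : Fin d → ℝ) (t : ℝ) : Ph d :=
  (fun k => (c k * Complex.exp ((κ k - ν k * Complex.I) * t)).re,
    fun k => (c k * Complex.exp ((κ k - ν k * Complex.I) * t)).im)

lemma complexCoord_spiral (c : Fin d → ℂ) (κ ν : Fin d → ℝ) (t : ℝ) (k : Fin d) :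
    complexCoord k (spiral c κ ν t) = c k * Complex.exp ((κ k - ν k * Complex.I) * t) := by
  apply Complex.ext
  · rw [complexCoord_re]; rfl
  · rw [complexCoord_im]; rfl

lemma hasDerivAt_spiral (c : Fin d → ℂ) (κ ν : Fin d → ℝ) (t : ℝ) :
    HasDerivAt (spiral c κ ν)
      (fun k => κ k * (spiral c κ ν t).1 k + ν k * (spiral c κ ν t).2 k,
        fun k => κ k * (spiral c κ ν t).2 k - ν k * (spiral c κ ν t).1 k) t := by
  have h (k : Fin d) : HasDerivAt (fun t : ℝ => c k * Complex.exp ((κ k - ν k * Complex.I) * t))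
      ((κ k - ν k * Complex.I) * (c k * Complex.exp ((κ k - ν k * Complex.I) * t))) t := by
    refine (((Complex.ofRealCLM.hasDerivAt (x := t)).const_mul
      (κ k - ν k * Complex.I)).cexp.const_mul (c k)).congr_deriv ?_
    simp; ring
  refine HasDerivAt.prodMk (hasDerivAt_pi.2 fun k => ?_) (hasDerivAt_pi.2 fun k => ?_)
  · refine (Complex.reCLM.hasFDerivAt.comp_hasDerivAt t (h k)).congr_deriv ?_
    simp only [Complex.reCLM_apply, spiral]
    rw [Complex.mul_re]
    simp
  · refine (Complex.imCLM.hasFDerivAt.comp_hasDerivAt t (h k)).congr_deriv ?_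
    simp only [Complex.imCLM_apply, spiral]
    rw [Complex.mul_im]
    simp; ring

lemma actJ_eq_norm_sq (k : Fin d) (x : Ph d) : actJ k x = ‖complexCoord k x‖ ^ 2 / 2 := by
  rw [← Complex.normSq_eq_norm_sq, Complex.normSq_apply]
  simp [actJ]; ring

lemma actJ_nonneg (k : Fin d) (x : Ph d) : 0 ≤ actJ k x := by
  unfold actJ; positivity

lemma actJ_spiral (c : Fin d → ℂ) (κ ν : Fin d → ℝ) (t : ℝ) (k : Fin d) :
    actJ k (spiral c κ ν t) = ‖c k‖ ^ 2 / 2 * Real.exp (2 * κ k * t) := by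
  have h : (2 * κ k * t) = κ k * t + κ k * t := by ring
  rw [actJ_eq_norm_sq, complexCoord_spiral, norm_mul, Complex.norm_exp, h, Real.exp_add]
  simp
  ring

lemma norm_sq_le_of_actJ_le {x : Ph d} {B : ℝ} (hB : 0 ≤ B) (h : ∀ k, actJ k x ≤ B) :
    ‖x‖ ^ 2 ≤ 2 * B := by
  rw [← Real.sq_sqrt (show 0 ≤ 2 * B by positivity)]
  gcongr
  refine norm_prod_le_iff.2 ⟨?_, ?_⟩ <;> refine (pi_norm_le_iff_of_nonneg (by positivity)).2 ?_
  · refine fun k => Real.abs_le_sqrt ?_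
    have := h k
    unfold actJ at this
    nlinarith [sq_nonneg (x.2 k)]
  · refine fun k => Real.abs_le_sqrt ?_
    have := h k
    unfold actJ at this
    nlinarith [sq_nonneg (x.1 k)]

lemma actJ_le_norm_sq (k : Fin d) (x : Ph d) : actJ k x ≤ ‖x‖ ^ 2 := by
  have h1 : ‖x.1 k‖ ≤ ‖x‖ := (norm_le_pi_norm _ k).trans (norm_fst_le x)
  have h2 : ‖x.2 k‖ ≤ ‖x‖ := (norm_le_pi_norm _ k).trans (norm_snd_le x)
  have h3 : x.1 k ^ 2 ≤ ‖x‖ ^ 2 := sq_le_sq' (abs_le.1 h1).1 (abs_le.1 h1).2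
  have h4 : x.2 k ^ 2 ≤ ‖x‖ ^ 2 := sq_le_sq' (abs_le.1 h2).1 (abs_le.1 h2).2
  unfold actJ
  linarith

/-- The sum of all actions but the `l`-th one. -/
def sumActErase (l : Fin d) (x : Ph d) : ℝ := ∑ k ∈ Finset.univ.erase l, actJ k x

lemma contDiff_sumActErase {n : WithTop ℕ∞} (l : Fin d) : ContDiff ℝ n (sumActErase l) := by
  unfold sumActErase; fun_prop

lemma actJ_le_sumActErase {k l : Fin d} (hkl : k ≠ l) (x : Ph d) : actJ k x ≤ sumActErase l x :=
  Finset.single_le_sum (fun k _ => actJ_nonneg k x) (Finset.mem_erase.2 ⟨hkl, Finset.mem_univ _⟩)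

lemma hasCompactSupport_of_actJ_lt (l : Fin d) {F : Ph d → ℝ} {B : ℝ}
    (h : ∀ x, F x ≠ 0 → actJ l x < B ∧ sumActErase l x < B) : HasCompactSupport F := by
  refine HasCompactSupport.intro (isCompact_closedBall (0 : Ph d) √(2 * B)) fun x hx => ?_
  by_contra hF
  obtain ⟨h1, h2⟩ := h x hF
  have hB : 0 ≤ B := (actJ_nonneg l x).trans h1.le
  refine hx (mem_closedBall_zero_iff.2 (Real.le_sqrt_of_sq_le (norm_sq_le_of_actJ_le hB fun k => ?_)))
  rcases eq_or_ne k l with rfl | hkl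
  exacts [h1.le, (actJ_le_sumActErase hkl x).trans h2.le]

lemma quadHam_add_single (ω : Fin d → ℝ) (i : Fin d) (δ : ℝ) (x : Ph d) :
    quadHam (ω + Pi.single i δ) x = quadHam ω x + δ * actJ i x := by
  simp [quadHam, add_mul, Finset.sum_add_distrib, Pi.single_apply]

/-- The amplitudes of the diffusing orbit: the phases make `z_i ^ q * z_j ^ p` purely imaginary. -/
def amplitude (i j l : Fin d) (q p : ℕ) (s a : ℝ) (k : Fin d) : ℂ :=
  if k = i then √(2 * (q * s)) * Complex.exp (-(Real.pi / (2 * q) : ℝ) * Complex.I)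
  else if k = j then √(2 * (p * s)) else if k = l then √(2 * a) else 0

lemma monomial_spiral_amplitude {i j l : Fin d} (hij : i ≠ j) {q p m : ℕ} (hq : 0 < q)
    (hm : q + p = 2 * (m + 1)) (s a μ : ℝ) {κ ν : Fin d → ℝ} (hi : κ i = μ) (hj : κ j = μ)
    (hν : q * ν i + p * ν j = 0) (t : ℝ) :
    monomial i j q p (spiral (amplitude i j l q p s a) κ ν t) = -Complex.I *
      (√(2 * (q * s)) ^ q * √(2 * (p * s)) ^ p * Real.exp (2 * μ * t) ^ (m + 1) : ℝ) := by
  have hq' : (q : ℂ) ≠ 0 := by exact_mod_cast hq.ne'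
  have hI : Complex.exp (-(Real.pi / (2 * q) : ℝ) * Complex.I) ^ q = -Complex.I := by
    rw [← Complex.exp_nat_mul, ← Complex.exp_neg_pi_div_two_mul_I]
    congr 1
    push_cast
    field_simp
  have hE : Complex.exp ((μ - ν i * Complex.I) * t) ^ q *
      Complex.exp ((μ - ν j * Complex.I) * t) ^ p = (Real.exp (2 * μ * t) : ℂ) ^ (m + 1) := by
    have hν' : (q * ν i + p * ν j : ℂ) = 0 := by exact_mod_cast hν
    have hm' : (q + p : ℂ) = 2 * (m + 1) := by exact_mod_cast hm
    rw [← Complex.exp_nat_mul, ← Complex.exp_nat_mul, ← Complex.exp_add, Complex.ofReal_exp,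
      ← Complex.exp_nat_mul]
    congr 1
    push_cast
    linear_combination (μ * t : ℂ) * hm' - Complex.I * t * hν'
  simp only [monomial, complexCoord_spiral, amplitude, if_true, if_neg hij.symm, hi, hj, mul_pow,
    hI]
  push_cast at hE ⊢
  linear_combination (-Complex.I * √(2 * (q * s)) ^ q * √(2 * (p * s)) ^ p : ℂ) * hE

/-- A Hamiltonian with an exact resonance between the `i`-th and `j`-th modes has an orbit along
which the corresponding actions grow exponentially. -/
lemma exists_resonant_orbit {i j l : Fin d} (hij : i ≠ j) (hil : i ≠ l) (hjl : j ≠ l)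
    {ν : Fin d → ℝ} {q p m : ℕ} (hq : 0 < q) (hp : 0 < p) (hm : q + p = 2 * (m + 1))
    (hν : q * ν i + p * ν j = 0) {a σ ε : ℝ} (ha : 0 ≤ a) (hσ : 0 < σ) (hε : 0 < ε) :
    ∃ (γ : ℝ → Ph d) (μ : ℝ), 0 < μ ∧ ∀ t, actJ l (γ t) = a ∧
      sumActErase l (γ t) = σ * Real.exp (2 * μ * t) ∧
      actJ i (γ t) + actJ j (γ t) = σ * Real.exp (2 * μ * t) ∧
      HasDerivAt γ (hamVF (fun x => quadHam ν x +
        ε * (sumActErase l x ^ m)⁻¹ * (monomial i j q p x).re) (γ t)) t := by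
  have hq' : (0 : ℝ) < q := by exact_mod_cast hq
  have hp' : (0 : ℝ) < p := by exact_mod_cast hp
  set s : ℝ := σ / (q + p) with hs_def
  have hs : 0 < s := by positivity
  have hqps : (q * s + p * s) = σ := by rw [hs_def]; field_simp
  set M₀ : ℝ := √(2 * (q * s)) ^ q * √(2 * (p * s)) ^ p
  have hM₀ : 0 < M₀ := by positivity
  set μ : ℝ := ε * (σ ^ m)⁻¹ * (M₀ / (2 * s)) with hμ_def
  set κ : Fin d → ℝ := fun k => if k = i ∨ k = j then μ else 0 with hκ
  have hκi : κ i = μ := by simp [hκ]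
  have hκj : κ j = μ := by simp [hκ]
  have hκl : κ l = 0 := by simp [hκ, hil.symm, hjl.symm]
  set γ := spiral (amplitude i j l q p s a) κ ν with hγ
  refine ⟨γ, μ, by positivity, fun t => ?_⟩
  set e := Real.exp (2 * μ * t) with he
  have he0 : 0 < e := Real.exp_pos _
  have hi : actJ i (γ t) = q * (s * e) := by
    rw [hγ, actJ_spiral, hκi, amplitude, if_pos rfl, norm_mul, ← Complex.ofReal_neg,
      Complex.norm_exp_ofReal_mul_I, Complex.norm_real, Real.norm_eq_abs, mul_one, sq_abs,
      Real.sq_sqrt (by positivity)]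
    ring
  have hj : actJ j (γ t) = p * (s * e) := by
    rw [hγ, actJ_spiral, hκj, amplitude, if_neg hij.symm, if_pos rfl, Complex.norm_real,
      Real.norm_eq_abs, sq_abs, Real.sq_sqrt (by positivity)]
    ring
  have hl : actJ l (γ t) = a := by
    rw [hγ, actJ_spiral, hκl, amplitude, if_neg hil.symm, if_neg hjl.symm, if_pos rfl,
      Complex.norm_real, Real.norm_eq_abs, sq_abs, Real.sq_sqrt (by positivity)]
    simp
  have hij' : actJ i (γ t) + actJ j (γ t) = σ * e := by rw [hi, hj, ← hqps]; ring
  have hρ : sumActErase l (γ t) = σ * e := by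
    rw [← hij', sumActErase]
    refine Finset.sum_eq_add i j hij (fun k hk hk' => ?_) (by simp [hil]) (by simp [hjl])
    rw [hγ, actJ_spiral, amplitude, if_neg hk'.1, if_neg hk'.2, if_neg (Finset.ne_of_mem_erase hk)]
    simp
  refine ⟨hl, hρ, hij', ?_⟩
  have hdiff : DifferentiableAt ℝ (fun x => ε * (sumActErase l x ^ m)⁻¹) (γ t) := by
    have h1 : Differentiable ℝ (sumActErase (d := d) l) :=
      (contDiff_sumActErase (n := 1) l).differentiable (by simp)
    exact (((h1 _).pow m).inv (pow_ne_zero m (by rw [hρ]; positivity))).const_mul ε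
  rw [hamVF_quadHam_add_resonant hij ν hq hp (mul_pos hs he0) hi hj
    (monomial_spiral_amplitude hij hq hm s a μ hκi hκj hν t) hdiff]
  refine (hasDerivAt_spiral _ κ ν t).congr_deriv ?_
  have hμ : ε * (sumActErase l (γ t) ^ m)⁻¹ * (M₀ * e ^ (m + 1) / (2 * (s * e))) = μ := by
    rw [hρ, hμ_def, mul_pow, pow_succ]
    field_simp
  rw [hμ]

lemma ContDiffBump.abs_sub_lt_of_ne_zero {a : ℝ} (b : ContDiffBump a) {r : ℝ} (h : b r ≠ 0) :
    |r - a| < b.rOut := by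
  by_contra! h'
  exact h (b.zero_of_le_dist (by rwa [Real.dist_eq]))

lemma exists_resonant_perturbation {ω : Fin d → ℝ} {i j l : Fin d} (hij : i ≠ j)
    (hil : i ≠ l) (hjl : j ≠ l) (hω : ω i * ω j < 0) {a σ R η : ℝ} (ha : 0 < a) (hσ : 0 < σ)
    (hσR : σ < R) (hη : 0 < η) (N : ℕ) :
    ∃ T : Ph d → ℝ, ContDiff ℝ (⊤ : ℕ∞) T ∧ (∀ p, T p ≠ 0 → |actJ l p - a| < a / 2) ∧
      (∀ k ≤ N, ∀ x, ‖iteratedFDeriv ℝ k T x‖ ≤ η) ∧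
      ∃ (γ : ℝ → Ph d) (τ : ℝ), 0 ≤ τ ∧
        (∀ t ∈ Icc 0 τ, HasDerivAt γ (hamVF (fun p => quadHam ω p + T p) (γ t)) t) ∧
        (∀ t, actJ l (γ t) = a) ∧ ‖γ 0‖ ^ 2 ≤ 2 * (a + σ) ∧ R ≤ 2 * ‖γ τ‖ ^ 2 := by
  have hR : 0 < R := hσ.trans hσR
  let b : ContDiffBump a := ⟨a / 4, a / 2, by positivity, by linarith⟩
  let χ : ContDiffBump ((R + σ) / 2) := ⟨R / 2, R / 2 + σ / 4, by positivity, by linarith⟩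
  have hχ : χ.rOut < (R + σ) / 2 := by change R / 2 + σ / 4 < _; linarith
  have hb : ContDiff ℝ (⊤ : ℕ∞) fun x : Ph d => b (actJ l x) := b.contDiff.comp (contDiff_actJ l)
  have hcut {F : Ph d → ℝ} : HasCompactSupport
      fun x => b (actJ l x) * χ (sumActErase l x) * F x := by
    refine hasCompactSupport_of_actJ_lt l (B := 2 * a + 2 * R) fun x hx => ?_
    have h1 : |_| < a / 2 := b.abs_sub_lt_of_ne_zero (left_ne_zero_of_mul (left_ne_zero_of_mul hx))
    have h2 : |_| < R / 2 + σ / 4 :=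
      χ.abs_sub_lt_of_ne_zero (right_ne_zero_of_mul (left_ne_zero_of_mul hx))
    rw [abs_lt] at h1 h2
    constructor <;> linarith
  have hG₁ : ContDiff ℝ (⊤ : ℕ∞)
      fun x : Ph d => b (actJ l x) * χ (sumActErase l x) * actJ i x :=
    (hb.mul (χ.contDiff.comp (contDiff_sumActErase l))).mul (contDiff_actJ i)
  obtain ⟨δ₀, hδ₀, hδ⟩ := exists_norm_iteratedFDeriv_const_mul_le hcut hG₁ N (half_pos hη)
  obtain ⟨δ, q', p', hδδ₀, hq', hp', hres⟩ := exists_resonant_shift hω hδ₀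
  obtain ⟨m, hm⟩ : ∃ m, q' + p' = m + 1 := ⟨q' + p' - 1, by omega⟩
  set ν : Fin d → ℝ := ω + Pi.single i δ with hν
  have hνres : ((2 * q' : ℕ) : ℝ) * ν i + ((2 * p' : ℕ) : ℝ) * ν j = 0 := by
    have h1 : ν i = ω i + δ := by simp [hν]
    have h2 : ν j = ω j := by simp [hν, hij.symm]
    rw [h1, h2]
    push_cast
    linear_combination 2 * hres
  set M : Ph d → ℝ := fun x => (monomial i j (2 * q') (2 * p') x).re
  have hG₂ : ContDiff ℝ (⊤ : ℕ∞) fun x : Ph d => b (actJ l x) * χ (sumActErase l x) *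
      ((sumActErase l x ^ m)⁻¹ * M x) := by
    have h := (hb.mul ((χ.contDiff_mul_inv_pow hχ m).comp (contDiff_sumActErase l))).mul
      (Complex.reCLM.contDiff.comp (contDiff_monomial i j (2 * q') (2 * p')))
    refine (congrArg (ContDiff ℝ (⊤ : ℕ∞)) (funext fun x => ?_)).mpr h
    simp only [M, Function.comp_apply, Complex.reCLM_apply]
    ring
  obtain ⟨ε, hε, hε'⟩ := exists_norm_iteratedFDeriv_const_mul_le hcut hG₂ N (half_pos hη)
  obtain ⟨γ, μ, hμ, hγ⟩ := exists_resonant_orbit (l := l) hij hil hjl (by omega : 0 < 2 * q')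
    (by omega : 0 < 2 * p') (by omega : 2 * q' + 2 * p' = 2 * (m + 1)) hνres ha.le hσ hε
  set G₁ : Ph d → ℝ := fun x => b (actJ l x) * χ (sumActErase l x) * actJ i x with hG₁_def
  set G₂ : Ph d → ℝ := fun x => b (actJ l x) * χ (sumActErase l x) *
    ((sumActErase l x ^ m)⁻¹ * M x) with hG₂_def
  have hT₁ : ContDiff ℝ (⊤ : ℕ∞) fun x => δ * G₁ x := contDiff_const.mul hG₁
  have hT₂ : ContDiff ℝ (⊤ : ℕ∞) fun x => ε * G₂ x := contDiff_const.mul hG₂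
  set τ := Real.log (R / σ) / (2 * μ) with hτ
  have hτ0 : 0 ≤ τ := div_nonneg (Real.log_nonneg ((one_le_div hσ).2 hσR.le)) (by positivity)
  have hρτ : σ * Real.exp (2 * μ * τ) = R := by
    rw [hτ, mul_div_cancel₀ _ (by positivity), Real.exp_log (by positivity)]
    field_simp
  refine ⟨fun x => δ * G₁ x + ε * G₂ x, hT₁.add hT₂, fun x hx => ?_, fun k hk x => ?_, γ, τ, hτ0,
    fun t ht => ?_, fun t => (hγ t).1, ?_, ?_⟩
  · refine b.abs_sub_lt_of_ne_zero fun hb0 => hx ?_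
    simp [hG₁_def, hG₂_def, hb0]
  · have hk' : (k : WithTop ℕ∞) ≤ (⊤ : ℕ∞) := WithTop.coe_le_coe.2 le_top
    have hadd : iteratedFDeriv ℝ k (fun x => δ * G₁ x + ε * G₂ x) x = _ :=
      iteratedFDeriv_add_apply (hT₁.contDiffAt.of_le hk') (hT₂.contDiffAt.of_le hk')
    rw [hadd]
    refine (norm_add_le _ _).trans ?_
    linarith [hδ δ hδδ₀ k hk x, hε' ε (abs_of_pos hε).le k hk x]
  · obtain ⟨hl, hρ, -, hd⟩ := hγ t
    refine hd.congr_deriv (hamVF_congr ?_)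
    have hb1 : b =ᶠ[𝓝 (actJ l (γ t))] 1 := b.eventuallyEq_one_of_mem_ball <| by
      rw [hl]; exact mem_ball_self b.rIn_pos
    have hχ1 : χ =ᶠ[𝓝 (sumActErase l (γ t))] 1 := χ.eventuallyEq_one_of_mem_ball <| by
      have h1 : σ ≤ sumActErase l (γ t) := by
        rw [hρ]
        exact le_mul_of_one_le_right hσ.le (Real.one_le_exp (by have := ht.1; positivity))
      have h2 : sumActErase l (γ t) ≤ R := by
        rw [hρ, ← hρτ]
        have := ht.2
        gcongr
      rw [mem_ball, Real.dist_eq, abs_lt]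
      change -(R / 2) < _ ∧ _ < R / 2
      constructor <;> linarith
    filter_upwards [(contDiff_actJ (n := 0) l).continuous.continuousAt.eventually hb1,
      (contDiff_sumActErase (n := 0) l).continuous.continuousAt.eventually hχ1] with x hx1 hx2
    simp only [hG₁_def, hG₂_def, hx1, hx2, hν, quadHam_add_single, Pi.one_apply, M]
    ring
  · refine norm_sq_le_of_actJ_le (by positivity) fun k => ?_
    obtain ⟨hl, hρ, -⟩ := hγ 0
    rcases eq_or_ne k l with rfl | hkl
    · linarith
    · have := actJ_le_sumActErase hkl (γ 0)
      simp only [hρ, mul_zero, Real.exp_zero, mul_one] at this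
      linarith
  · have h := (hγ τ).2.2.1
    rw [hρτ] at h
    linarith [actJ_le_norm_sq i (γ τ), actJ_le_norm_sq j (γ τ)]

end Resonance

lemma eq_of_abs_sub_quarter_pow_lt {m n : ℕ} {r : ℝ}
    (hm : |r - (1 / 4 : ℝ) ^ m| < (1 / 4 : ℝ) ^ m / 2)
    (hn : |r - (1 / 4 : ℝ) ^ n| < (1 / 4 : ℝ) ^ n / 2) : m = n := by
  wlog h : m < n generalizing m n
  · rcases lt_trichotomy m n with h' | h' | h'
    exacts [this hm hn h', h', (this hn hm h').symm]
  have : (1 / 4 : ℝ) ^ n ≤ (1 / 4) ^ (m + 1) :=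
    pow_le_pow_of_le_one (by norm_num) (by norm_num) h
  rw [pow_succ] at this
  rw [abs_lt] at hm hn
  have h4 : (0 : ℝ) < (1 / 4) ^ m := by positivity
  linarith [hm.1, hn.2]

theorem statement2 (d : ℕ) (hd : 4 ≤ d) (ω₀ : Fin d → ℝ)
    (hsign : ∃ i j : Fin d, ω₀ i * ω₀ j < 0) :
    ∃ H : Ph d → ℝ, ContDiff ℝ (⊤ : ℕ∞) H ∧ IsEllipticNF ω₀ H ∧
      ∃ Φ : ℝ → Ph d → Ph d, IsGlobalFlow H Φ ∧
        ∀ A : ℝ, 0 < A → ∃ p : Ph d, ∃ t₁ t₂ : ℝ,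
          ‖Φ t₁ p‖ ≤ A⁻¹ ∧ A ≤ ‖Φ t₂ p‖ := by
  obtain ⟨i, j, hω⟩ := hsign
  have hij : i ≠ j := by
    rintro rfl
    exact absurd hω (not_lt.2 (mul_self_nonneg _))
  obtain ⟨l, hl⟩ : ∃ l, l ∉ ({i, j} : Finset (Fin d)) := by
    by_contra! h
    have h1 : Finset.univ ⊆ ({i, j} : Finset (Fin d)) := fun x _ => h x
    have h2 := (Finset.card_le_card h1).trans Finset.card_le_two
    rw [Finset.card_univ, Fintype.card_fin] at h2
    omega
  simp only [Finset.mem_insert, Finset.mem_singleton, not_or] at hl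
  have key (n : ℕ) := exists_resonant_perturbation hij (Ne.symm hl.1) (Ne.symm hl.2) hω
    (a := (1 / 4) ^ n) (σ := (1 / 4) ^ n) (R := n + 2) (η := (1 / 2) ^ n) (by positivity)
    (by positivity)
    (by have : (1 / 4 : ℝ) ^ n ≤ 1 := pow_le_one₀ (by norm_num) (by norm_num)
        have : (0 : ℝ) ≤ n := n.cast_nonneg
        linarith) (by positivity) (n + 2)
  choose T hT hsupp hb γ τ hτ hγ hγl hγ0 hγτ using key
  set S : Ph d → ℝ := fun p => ∑' n, T n p with hS
  have hSsm : ContDiff ℝ (⊤ : ℕ∞) S := contDiff_tsum_of_geometric hT hb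
  have hQsm : ContDiff ℝ (⊤ : ℕ∞) (quadHam ω₀) := contDiff_quadHam ω₀
  have hact (p : Ph d) : ContinuousAt (actJ l) p :=
    (contDiff_actJ (n := 0) l).continuous.continuousAt
  have hHsm : ContDiff ℝ (⊤ : ℕ∞) (fun p => quadHam ω₀ p + S p) := hQsm.add hSsm
  have hHloc (n : ℕ) (p : Ph d) (hp : actJ l p = (1 / 4) ^ n) :
      (fun q => quadHam ω₀ q + S q) =ᶠ[𝓝 p] fun q => quadHam ω₀ q + T n q := by
    have hp' : |actJ l p - (1 / 4) ^ n| < (1 / 4 : ℝ) ^ n / 2 := by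
      rw [hp, sub_self, abs_zero]; positivity
    have : ∀ᶠ q in 𝓝 p, |actJ l q - (1 / 4) ^ n| < (1 / 4 : ℝ) ^ n / 2 :=
      ((hact p).sub continuousAt_const).abs.eventually_lt continuousAt_const hp'
    filter_upwards [this] with q hq
    simp only [hS]
    rw [tsum_eq_single n fun m hmn => ?_]
    by_contra h
    exact hmn (eq_of_abs_sub_quarter_pow_lt (hsupp m q h) hq)
  have hT0 (n : ℕ) : T n =ᶠ[𝓝 0] fun _ => 0 := by
    have : ∀ᶠ q in 𝓝 (0 : Ph d), actJ l q < (1 / 4 : ℝ) ^ n / 2 :=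
      (hact 0).eventually_lt continuousAt_const (by simp only [actJ]; simp)
    filter_upwards [this] with q hq
    by_contra h
    have := (abs_lt.1 (hsupp n q h)).1
    linarith
  obtain ⟨K, hK⟩ := exists_lipschitzWith_hamVF_quadHam ω₀
  have hlip := hK.add ((symplecticSharp d).toContinuousLinearMap.lipschitz.comp
    (lipschitzWith_fderiv_tsum_of_geometric hT hb))
  rw [← hamVF_eq_symplecticSharp, ← hamVF_add (hQsm.differentiable (by simp))
    (hSsm.differentiable (by simp))] at hlip
  obtain ⟨Φ, hΦ⟩ := hlip.exists_flow (contDiff_hamVF hHsm)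
  refine ⟨fun p => quadHam ω₀ p + S p, hHsm, fun k hk => ?_, Φ, hΦ, fun A hA => ?_⟩
  · have : (fun p => quadHam ω₀ p + S p - ∑ j, ω₀ j * actJ j p) = S := by
      ext p; simp [quadHam]
    rw [this, iteratedFDeriv_tsum_of_geometric hT hb hk]
    have h0 (n : ℕ) : iteratedFDeriv ℝ k (T n) 0 = 0 := by
      rw [((hT0 n).iteratedFDeriv ℝ k).self_of_nhds]
      simp
    simp [h0]
  obtain ⟨n₁, hn₁⟩ := exists_nat_ge (2 * A ^ 2)
  obtain ⟨n₂, hn₂⟩ := exists_pow_lt_of_lt_one (show 0 < A⁻¹ ^ 2 / 4 by positivity)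
    (show (1 / 4 : ℝ) < 1 by norm_num)
  set n := max n₁ n₂
  have h1 : 2 * A ^ 2 ≤ n := hn₁.trans (by exact_mod_cast le_max_left _ _)
  have h2 : (1 / 4 : ℝ) ^ n ≤ A⁻¹ ^ 2 / 4 :=
    (pow_le_pow_of_le_one (by norm_num) (by norm_num) (le_max_right _ _)).trans hn₂.le
  refine ⟨γ n 0, 0, τ n, ?_, ?_⟩
  · rw [hΦ.1]
    exact le_of_sq_le_sq (by linarith [hγ0 n]) (by positivity)
  · have heq : EqOn (fun t => Φ t (γ n 0)) (γ n) (Icc 0 (τ n)) := by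
      have hd (t) (ht : t ∈ Icc 0 (τ n)) :
          HasDerivAt (γ n) (hamVF (fun p => quadHam ω₀ p + S p) (γ n t)) t := by
        rw [hamVF_congr (hHloc n _ (hγl n t))]
        exact hγ n t ht
      refine ODE_solution_unique (v := fun _ => hamVF fun p => quadHam ω₀ p + S p) (fun _ => hlip)
        (HasDerivAt.continuousOn fun t _ => hΦ.2.2 _ t) (fun t _ => (hΦ.2.2 _ t).hasDerivWithinAt)
        (HasDerivAt.continuousOn hd) (fun t ht => (hd t (Ico_subset_Icc_self ht)).hasDerivWithinAt)
        (hΦ.1 _)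
    have : Φ (τ n) (γ n 0) = γ n (τ n) := heq ⟨hτ n, le_rfl⟩
    rw [this]
    exact le_of_sq_le_sq (by linarith [hγτ n]) (norm_nonneg _)
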